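/- There exist sets A, B ⊆ ℕ such that B is cofinitely reducible to A but B is not use-bounded-from-below reducible to A. -/

import Mathlib

open Filter

/-- A finite record of oracle query answers: a finite list of (position, bit) pairs. -/
abbrev FinInfo : Type := List (ℕ × Bool)

/-- Two finite query-answer records are compatible if they agree wherever both answer. -/
def FinInfo.Compatible (σ τ : FinInfo) : Prop :=
  ∀ p ∈ σ, ∀ q ∈ τ, p.1 = q.1 → p.2 = q.2

/-- The answers recorded in `σ` are exactly those given by the characteristic
function of the set `C`. -/
def AgreesSet (σ : FinInfo) (C : Set ℕ) : Prop :=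
  ∀ p ∈ σ, (p.2 = true ↔ p.1 ∈ C)

/-- The answers recorded in `σ` are all given by the partial oracle `g`. -/
def AgreesPart (σ : FinInfo) (g : ℕ →. Bool) : Prop :=
  ∀ p ∈ σ, p.2 ∈ g p.1

/-- `g` is a partial oracle for the set `A`: a partial function from `ℕ` to `Bool`
agreeing with the characteristic function of `A` on its domain. -/
def IsPartialOracle (g : ℕ →. Bool) (A : Set ℕ) : Prop :=
  ∀ n b, b ∈ g n → (b = true ↔ n ∈ A)

/-- The domain of a partial oracle. -/
def pDom (g : ℕ →. Bool) : Set ℕ := {n | (g n).Dom}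

/-- A Turing functional (oracle Turing machine program), presented as a computable
enumeration of axioms `(σ, n, b)`, meaning: if the oracle answers the queries
recorded in `σ` as `σ` prescribes, then the machine halts on input `n` with
output `b`.  Oracle queries are made in parallel, so with a partial oracle the
machine halts on `n` iff some axiom for `n` is answered by the partial oracle.
Determinism of the machine is reflected in the requirement that axioms with
compatible query answers give equal outputs. -/
structure TuringFunctional where
  axs : ℕ → Option (FinInfo × ℕ × Bool)
  axs_computable : Computable axs
  consistent : ∀ k₁ k₂ σ₁ σ₂ n b₁ b₂, axs k₁ = some (σ₁, n, b₁) →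
    axs k₂ = some (σ₂, n, b₂) → σ₁.Compatible σ₂ → b₁ = b₂

namespace TuringFunctional

/-- `Φ^C(n)` halts with output `b` (total oracle `C`). -/
def HaltsT (Φ : TuringFunctional) (C : Set ℕ) (n : ℕ) (b : Bool) : Prop :=
  ∃ k σ, Φ.axs k = some (σ, n, b) ∧ AgreesSet σ C

/-- `Φ^g(n)` halts with output `b` (partial oracle `g`). -/
def HaltsP (Φ : TuringFunctional) (g : ℕ →. Bool) (n : ℕ) (b : Bool) : Prop :=
  ∃ k σ, Φ.axs k = some (σ, n, b) ∧ AgreesPart σ g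

/-- `Φ^C` is total. -/
def TotalOn (Φ : TuringFunctional) (C : Set ℕ) : Prop := ∀ n, ∃ b, Φ.HaltsT C n b

/-- The set `{n : Φ^C(n) = B(n)}` on which `Φ^C` halts and agrees with the
characteristic function of `B`. -/
def AgreeSet (Φ : TuringFunctional) (C B : Set ℕ) : Set ℕ :=
  {n | ∃ b, Φ.HaltsT C n b ∧ (b = true ↔ n ∈ B)}

/-- `Φ^A = B`: with oracle `A`, `Φ` is total and computes the characteristic
function of `B`. -/
def FunEq (Φ : TuringFunctional) (A B : Set ℕ) : Prop :=
  Φ.TotalOn A ∧ ∀ n b, Φ.HaltsT A n b → (b = true ↔ n ∈ B)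

/-- `Φ^g ≃ B`: every halting output of `Φ` with partial oracle `g` agrees with
the characteristic function of `B`. -/
def PAgrees (Φ : TuringFunctional) (g : ℕ →. Bool) (B : Set ℕ) : Prop :=
  ∀ n b, Φ.HaltsP g n b → (b = true ↔ n ∈ B)

/-- The domain of `Φ^g`. -/
def PDomain (Φ : TuringFunctional) (g : ℕ →. Bool) : Set ℕ :=
  {n | ∃ b, Φ.HaltsP g n b}

/-- The axiom with index `k` applies to oracle `C` on input `n`. -/
def AppliesAt (Φ : TuringFunctional) (C : Set ℕ) (n k : ℕ) : Prop :=
  ∃ σ b, Φ.axs k = some (σ, n, b) ∧ AgreesSet σ C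

/-- The (halting) computation of `Φ^C(n)` queries the oracle bit `C(m)`:
the first axiom in the enumeration that applies to `C` on input `n`
records an answer to a query at position `m`. -/
def QueriesAt (Φ : TuringFunctional) (C : Set ℕ) (n m : ℕ) : Prop :=
  ∃ k σ b, Φ.axs k = some (σ, n, b) ∧ AgreesSet σ C ∧
    (∀ k' < k, ¬ Φ.AppliesAt C n k') ∧ ∃ p ∈ σ, p.1 = m

end TuringFunctional

/-- `D ⊆ ℕ` has (asymptotic) density 1. -/
def DensityOne (D : Set ℕ) : Prop :=
  Filter.Tendsto (fun n : ℕ => ((D ∩ Set.Iio n).ncard : ℝ) / n) Filter.atTop (nhds 1)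

/-- `B ≤₁ A`: 1-reducibility. -/
def OneRed (B A : Set ℕ) : Prop :=
  ∃ f : ℕ → ℕ, Computable f ∧ Function.Injective f ∧ ∀ n, n ∈ B ↔ f n ∈ A

/-- `B ≤_T A`: Turing reducibility. -/
def TuringRed (B A : Set ℕ) : Prop :=
  ∃ Φ : TuringFunctional, Φ.FunEq A B

/-- `B ≤_mr A`: mod-recursive reducibility. -/
def ModRecRed (B A : Set ℕ) : Prop :=
  ∃ Φ : TuringFunctional, Φ.FunEq A B ∧
    ∀ C : Set ℕ, ComputablePred (fun n => (n ∈ C ↔ n ∈ A)) →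
      Φ.TotalOn C ∧ ComputablePred (fun n => n ∈ Φ.AgreeSet C B)

/-- `B ≤_mf A`: mod-finite reducibility. -/
def ModFinRed (B A : Set ℕ) : Prop :=
  ∃ Φ : TuringFunctional, Φ.FunEq A B ∧
    ∀ C : Set ℕ, {n | ¬ (n ∈ C ↔ n ∈ A)}.Finite →
      Φ.TotalOn C ∧ (Φ.AgreeSet C B)ᶜ.Finite

/-- `B ≤_cor A`: coarse reducibility. -/
def CoarseRed (B A : Set ℕ) : Prop :=
  ∃ Φ : TuringFunctional,
    ∀ C : Set ℕ, DensityOne {n | n ∈ C ↔ n ∈ A} →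
      Φ.TotalOn C ∧ DensityOne (Φ.AgreeSet C B)

/-- `B ≤_cf A`: cofinite reducibility. -/
def CofinRed (B A : Set ℕ) : Prop :=
  ∃ Φ : TuringFunctional, Φ.FunEq A B ∧
    ∀ g : ℕ →. Bool, IsPartialOracle g A → (pDom g)ᶜ.Finite →
      Φ.PAgrees g B ∧ (Φ.PDomain g)ᶜ.Finite

/-- `B ≤_g A`: generic reducibility. -/
def GenericRed (B A : Set ℕ) : Prop :=
  ∃ Φ : TuringFunctional, Φ.FunEq A B ∧
    ∀ g : ℕ →. Bool, IsPartialOracle g A → DensityOne (pDom g) →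
      Φ.PAgrees g B ∧ DensityOne (Φ.PDomain g)

/-- `B ≤_ii A`: infinite-information reducibility. -/
def IIRed (B A : Set ℕ) : Prop :=
  ∃ Φ : TuringFunctional,
    ∀ g : ℕ →. Bool, IsPartialOracle g A → (pDom g).Infinite →
      Φ.PAgrees g B ∧ (Φ.PDomain g).Infinite

/-- `B ≤_ubfb A`: use-bounded-from-below reducibility. -/
def UbfbRed (B A : Set ℕ) : Prop :=
  ∃ Φ : TuringFunctional, Φ.FunEq A B ∧
    ∀ m : ℕ, ∀ᶠ n in Filter.atTop, ¬ Φ.QueriesAt A n m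

/-- `R(S) = {2^n · m : n ∈ S, m odd}`. -/
def Rmap (S : Set ℕ) : Set ℕ :=
  {x | ∃ n ∈ S, ∃ m : ℕ, Odd m ∧ x = 2 ^ n * m}

/-- `R̃(S) = {2^n + m : n ∈ S, m < 2^n}`. -/
def Rtilde (S : Set ℕ) : Set ℕ :=
  {x | ∃ n ∈ S, ∃ m : ℕ, m < 2 ^ n ∧ x = 2 ^ n + m}

/-- The Turing join `A ⊕ B`. -/
def turingJoin (A B : Set ℕ) : Set ℕ :=
  {x | (∃ n ∈ A, x = 2 * n) ∨ (∃ n ∈ B, x = 2 * n + 1)}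

/-- `Nat.pair n (s + 1)` is the least element of `A` in the `n`-th row past its `0`-th column. -/
def FirstMark (A : Set ℕ) (n s : ℕ) : Prop :=
  Nat.pair n (s + 1) ∈ A ∧ ∀ t < s, Nat.pair n (t + 1) ∉ A

theorem FirstMark.unique {A : Set ℕ} {n s t : ℕ} (hs : FirstMark A n s) (ht : FirstMark A n t) :
    s = t := by
  rcases lt_trichotomy s t with h | h | h
  · exact absurd hs.1 (ht.2 s h)
  · exact h
  · exact absurd ht.1 (hs.2 t h)

theorem FirstMark.congr {A A' : Set ℕ} {n s : ℕ} (hs : FirstMark A n s)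
    (h : ∀ t, Nat.pair n (t + 1) ∈ A ↔ Nat.pair n (t + 1) ∈ A') : FirstMark A' n s :=
  ⟨(h s).1 hs.1, fun t ht hA => hs.2 t ht ((h t).2 hA)⟩

theorem exists_firstMark {A : Set ℕ} {n t : ℕ} (h : Nat.pair n (t + 1) ∈ A) :
    ∃ s, FirstMark A n s := by
  classical
  have hex : ∃ t, Nat.pair n (t + 1) ∈ A := ⟨t, h⟩
  exact ⟨Nat.find hex, Nat.find_spec hex, fun t ht => Nat.find_min hex ht⟩

/-- The switch controlling the input `n` is the bit `Nat.pair n.unpair.1 0`.  The set coded by `A`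
consists of those `n` whose switch is off and whose row has its first mark at an odd place. -/
def coded (A : Set ℕ) : Set ℕ :=
  {n | Nat.pair n.unpair.1 0 ∉ A ∧ ∃ s, s.bodd = true ∧ FirstMark A n s}

/-- The query record stating that the first mark in row `n` is at place `s`. -/
def rowRecord (n s : ℕ) : FinInfo :=
  (Nat.pair n (s + 1), true) :: (List.range s).map fun t => (Nat.pair n (t + 1), false)

theorem agreesSet_rowRecord {A : Set ℕ} {n s : ℕ} :
    AgreesSet (rowRecord n s) A ↔ FirstMark A n s := by
  simp [AgreesSet, rowRecord, FirstMark]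

/-- The rules by which the coded set is decided at `n`: rule `0` says that `n` is out if its switch
is on, rule `s + 1` decides `n` when the first mark in its row is at place `s`. -/
def decodeRule (n s : ℕ) : FinInfo × ℕ × Bool :=
  Nat.casesOn s ([(Nat.pair n.unpair.1 0, true)], n, false) fun s =>
    (bif s.bodd then (Nat.pair n.unpair.1 0, false) :: rowRecord n s else rowRecord n s,
      n, s.bodd)

theorem primrec₂_rowRecord : Primrec₂ rowRecord := by
  have h : Primrec₂ fun (p : ℕ × ℕ) (t : ℕ) => ((Nat.pair p.1 (t + 1), false) : ℕ × Bool) :=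
    Primrec.pair (Primrec₂.natPair.comp (Primrec.fst.comp Primrec.fst)
      (Primrec.succ.comp Primrec.snd)) (Primrec.const false)
  exact Primrec.list_cons.comp
    (Primrec.pair (Primrec₂.natPair.comp Primrec.fst (Primrec.succ.comp Primrec.snd))
      (Primrec.const true))
    (Primrec.list_map (Primrec.list_range.comp Primrec.snd) h)

theorem primrec₂_decodeRule : Primrec₂ decodeRule := by
  have hsw : Primrec fun n : ℕ => Nat.pair n.unpair.1 0 :=
    Primrec₂.natPair.comp (Primrec.fst.comp Primrec.unpair) (Primrec.const 0)
  have hrow : Primrec fun x : (ℕ × ℕ) × ℕ => rowRecord x.1.1 x.2 :=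
    primrec₂_rowRecord.comp (Primrec.fst.comp Primrec.fst) Primrec.snd
  have hodd : Primrec fun x : (ℕ × ℕ) × ℕ => x.2.bodd := Primrec.nat_bodd.comp Primrec.snd
  have hn : Primrec fun x : (ℕ × ℕ) × ℕ => x.1.1 := Primrec.fst.comp Primrec.fst
  refine Primrec.nat_casesOn (f := fun p : ℕ × ℕ => p.2)
    (g := fun p => ([(Nat.pair p.1.unpair.1 0, true)], p.1, false))
    (h := fun p s => (bif s.bodd then (Nat.pair p.1.unpair.1 0, false) :: rowRecord p.1 s
      else rowRecord p.1 s, p.1, s.bodd)) Primrec.snd ?_ ?_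
  · exact Primrec.pair
      (Primrec.list_cons.comp (Primrec.pair (hsw.comp Primrec.fst) (Primrec.const true))
        (Primrec.const []))
      (Primrec.pair Primrec.fst (Primrec.const false))
  · exact Primrec.pair
      (Primrec.cond hodd
        (Primrec.list_cons.comp (Primrec.pair (hsw.comp hn) (Primrec.const false)) hrow) hrow)
      (Primrec.pair hn hodd)

theorem decodeRule_fst (n s : ℕ) : (decodeRule n s).2.1 = n := by
  cases s <;> rfl

theorem mem_decodeRule_succ {n s : ℕ} {p : ℕ × Bool} (h : p ∈ rowRecord n s) :
    p ∈ (decodeRule n (s + 1)).1 := by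
  cases hs : s.bodd <;> simp [decodeRule, hs, h]

theorem not_compatible_decodeRule_of_lt {n s t : ℕ} (h : s < t) :
    ¬ (decodeRule n (s + 1)).1.Compatible (decodeRule n (t + 1)).1 := by
  intro hc
  have := hc (Nat.pair n (s + 1), true) (mem_decodeRule_succ (by simp [rowRecord]))
    (Nat.pair n (s + 1), false) (mem_decodeRule_succ (by simp [rowRecord, h])) rfl
  simp at this

theorem FinInfo.Compatible.symm {σ τ : FinInfo} (h : σ.Compatible τ) : τ.Compatible σ :=
  fun p hp q hq hpq => (h q hq p hp hpq.symm).symm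

theorem decodeRule_zero_succ {n s : ℕ}
    (h : (decodeRule n 0).1.Compatible (decodeRule n (s + 1)).1) : s.bodd = false := by
  by_contra hs
  have hs : s.bodd = true := by simpa using hs
  have := h (Nat.pair n.unpair.1 0, true) (by simp [decodeRule])
    (Nat.pair n.unpair.1 0, false) (by simp [decodeRule, hs]) rfl
  simp at this

theorem decodeRule_consistent {n s t : ℕ}
    (h : (decodeRule n s).1.Compatible (decodeRule n t).1) :
    (decodeRule n s).2.2 = (decodeRule n t).2.2 := by
  rcases s with _ | s <;> rcases t with _ | t
  · rfl
  · exact (decodeRule_zero_succ h).symm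
  · exact decodeRule_zero_succ h.symm
  · rcases lt_trichotomy s t with hst | rfl | hst
    · exact absurd h (not_compatible_decodeRule_of_lt hst)
    · rfl
    · exact absurd h.symm (not_compatible_decodeRule_of_lt hst)

/-- The functional computing `coded A` from `A`. -/
def decoder : TuringFunctional where
  axs k := some (decodeRule k.unpair.1 k.unpair.2)
  axs_computable := (Primrec.option_some.comp (primrec₂_decodeRule.comp
    (Primrec.fst.comp Primrec.unpair) (Primrec.snd.comp Primrec.unpair))).to_comp
  consistent := by
    intro k₁ k₂ σ₁ σ₂ n b₁ b₂ h₁ h₂ hc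
    simp only [Option.some.injEq] at h₁ h₂
    have hn₁ := decodeRule_fst k₁.unpair.1 k₁.unpair.2
    have hn₂ := decodeRule_fst k₂.unpair.1 k₂.unpair.2
    rw [h₁] at hn₁
    rw [h₂] at hn₂
    rw [← hn₁] at h₁
    rw [← hn₂] at h₂
    have := decodeRule_consistent (n := n) (s := k₁.unpair.2) (t := k₂.unpair.2)
      (by rw [h₁, h₂]; exact hc)
    rwa [h₁, h₂] at this

theorem decoder_haltsT_iff {A : Set ℕ} {n : ℕ} {b : Bool} :
    decoder.HaltsT A n b ↔ ∃ s, AgreesSet (decodeRule n s).1 A ∧ (decodeRule n s).2.2 = b := by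
  constructor
  · rintro ⟨k, σ, hk, hσ⟩
    simp only [decoder, Option.some.injEq] at hk
    have hn := decodeRule_fst k.unpair.1 k.unpair.2
    rw [hk] at hn
    rw [← hn] at hk
    exact ⟨k.unpair.2, by rw [hk]; exact hσ, by rw [hk]⟩
  · rintro ⟨s, hs, hb⟩
    refine ⟨Nat.pair n s, (decodeRule n s).1, ?_, hs⟩
    simp only [decoder, Nat.unpair_pair, Option.some.injEq]
    exact Prod.ext rfl (Prod.ext (decodeRule_fst n s) hb)

theorem decoder_haltsP {g : ℕ →. Bool} {n s : ℕ} (h : AgreesPart (decodeRule n s).1 g) :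
    n ∈ decoder.PDomain g := by
  refine ⟨(decodeRule n s).2.2, Nat.pair n s, (decodeRule n s).1, ?_, h⟩
  simp only [decoder, Nat.unpair_pair, Option.some.injEq]
  exact Prod.ext rfl (Prod.ext (decodeRule_fst n s) rfl)

theorem agreesSet_decodeRule_zero {A : Set ℕ} {n : ℕ} :
    AgreesSet (decodeRule n 0).1 A ↔ Nat.pair n.unpair.1 0 ∈ A := by
  simp [AgreesSet, decodeRule]

theorem agreesSet_decodeRule_succ {A : Set ℕ} {n s : ℕ} :
    AgreesSet (decodeRule n (s + 1)).1 A ↔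
      (s.bodd = true → Nat.pair n.unpair.1 0 ∉ A) ∧ FirstMark A n s := by
  rw [← agreesSet_rowRecord]
  cases hs : s.bodd <;> simp [AgreesSet, decodeRule, hs]

theorem decoder_correct {A : Set ℕ} {n : ℕ} {b : Bool} (h : decoder.HaltsT A n b) :
    b = true ↔ n ∈ coded A := by
  obtain ⟨s, hs, rfl⟩ := decoder_haltsT_iff.1 h
  rcases s with _ | s
  · rw [agreesSet_decodeRule_zero] at hs
    simp [decodeRule, coded, hs]
  · rw [agreesSet_decodeRule_succ] at hs
    refine ⟨fun hb => ⟨hs.1 hb, s, hb, hs.2⟩, ?_⟩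
    rintro ⟨-, t, ht, hm⟩
    rw [hs.2.unique hm]
    exact ht

theorem exists_decodeRule {A : Set ℕ} {n : ℕ}
    (h : Nat.pair n.unpair.1 0 ∈ A ∨ ∃ s, FirstMark A n s) :
    ∃ s, AgreesSet (decodeRule n s).1 A := by
  by_cases hsw : Nat.pair n.unpair.1 0 ∈ A
  · exact ⟨0, agreesSet_decodeRule_zero.2 hsw⟩
  · obtain ⟨s, hs⟩ := h.resolve_left hsw
    exact ⟨s + 1, agreesSet_decodeRule_succ.2 ⟨fun _ => hsw, hs⟩⟩

theorem decoder_funEq {A : Set ℕ}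
    (h : ∀ n, Nat.pair n.unpair.1 0 ∈ A ∨ ∃ s, FirstMark A n s) :
    decoder.FunEq A (coded A) := by
  refine ⟨fun n => ?_, fun n b hb => decoder_correct hb⟩
  obtain ⟨s, hs⟩ := exists_decodeRule (h n)
  exact ⟨_, decoder_haltsT_iff.2 ⟨s, hs, rfl⟩⟩

theorem IsPartialOracle.agreesSet {g : ℕ →. Bool} {A : Set ℕ} (hg : IsPartialOracle g A)
    {σ : FinInfo} (h : AgreesPart σ g) : AgreesSet σ A :=
  fun p hp => hg p.1 p.2 (h p hp)

theorem IsPartialOracle.agreesPart {g : ℕ →. Bool} {A : Set ℕ} (hg : IsPartialOracle g A)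
    {σ : FinInfo} (h : AgreesSet σ A) (hσ : ∀ p ∈ σ, p.1 ∈ pDom g) : AgreesPart σ g := by
  intro p hp
  have hmem := Part.get_mem (hσ p hp)
  have h₁ := hg _ _ hmem
  have h₂ := h p hp
  rwa [show (g p.1).get (hσ p hp) = p.2 from Bool.eq_iff_iff.2 (h₁.trans h₂.symm)] at hmem

theorem le_of_mem_rowRecord {n s : ℕ} {p : ℕ × Bool} (h : p ∈ rowRecord n s) : n ≤ p.1 := by
  simp only [rowRecord, List.mem_cons, List.mem_map] at h
  rcases h with rfl | ⟨t, -, rfl⟩ <;> exact Nat.left_le_pair _ _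

theorem le_of_mem_decodeRule {n s : ℕ} {p : ℕ × Bool} (h : p ∈ (decodeRule n s).1) :
    n.unpair.1 ≤ p.1 := by
  rcases s with _ | s
  · obtain rfl := List.mem_singleton.1 h
    exact Nat.left_le_pair n.unpair.1 0
  · cases hs : s.bodd <;> simp only [decodeRule, hs, cond_true, cond_false, List.mem_cons] at h
    · exact (Nat.unpair_left_le n).trans (le_of_mem_rowRecord h)
    · rcases h with rfl | h
      · exact Nat.left_le_pair n.unpair.1 0
      · exact (Nat.unpair_left_le n).trans (le_of_mem_rowRecord h)

theorem cofinRed_coded {A : Set ℕ}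
    (h : ∀ n, Nat.pair n.unpair.1 0 ∈ A ∨ ∃ s, FirstMark A n s)
    (h' : ∀ e, ∃ N, ∀ n ≥ N, n.unpair.1 < e → ∃ s, s.bodd = false ∧ FirstMark A n s) :
    CofinRed (coded A) A := by
  refine ⟨decoder, decoder_funEq h, fun g hg hfin => ⟨?_, ?_⟩⟩
  · rintro n b ⟨k, σ, hk, hσ⟩
    exact decoder_correct ⟨k, σ, hk, hg.agreesSet hσ⟩
  · obtain ⟨K, hK⟩ := hfin.bddAbove
    have hdom : ∀ x, K < x → x ∈ pDom g := fun x hx => by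
      by_contra hxg
      exact absurd (hK hxg) (by omega)
    obtain ⟨N, hN⟩ := h' (K + 1)
    refine (Set.finite_Iio (max N (K + 1))).subset fun n hn => ?_
    by_contra hlt
    simp only [Set.mem_Iio, not_lt, max_le_iff] at hlt
    apply hn
    by_cases he : n.unpair.1 < K + 1
    · obtain ⟨s, hs, hm⟩ := hN n hlt.1 he
      refine decoder_haltsP (s := s + 1) (hg.agreesPart ?_ fun p hp => hdom _ ?_)
      · exact agreesSet_decodeRule_succ.2 ⟨by simp [hs], hm⟩
      · simp only [decodeRule, hs, cond_false] at hp
        have := le_of_mem_rowRecord hp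
        omega
    · obtain ⟨s, hs⟩ := exists_decodeRule (h n)
      refine decoder_haltsP (hg.agreesPart hs fun p hp => hdom _ ?_)
      have := le_of_mem_decodeRule hp
      omega

namespace TuringFunctional

theorem HaltsT.unique {Φ : TuringFunctional} {C : Set ℕ} {n : ℕ} {b b' : Bool}
    (h : Φ.HaltsT C n b) (h' : Φ.HaltsT C n b') : b = b' := by
  obtain ⟨k, σ, hk, hσ⟩ := h
  obtain ⟨k', σ', hk', hσ'⟩ := h'
  refine Φ.consistent k k' σ σ' n b b' hk hk' fun p hp q hq hpq => Bool.eq_iff_iff.2 ?_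
  rw [hσ p hp, hσ' q hq, hpq]

theorem HaltsT.queriesAt_or {Φ : TuringFunctional} {C : Set ℕ} {n : ℕ} {b : Bool}
    (h : Φ.HaltsT C n b) (m : ℕ) :
    Φ.QueriesAt C n m ∨
      ∃ k σ, Φ.axs k = some (σ, n, b) ∧ AgreesSet σ C ∧ ∀ p ∈ σ, p.1 ≠ m := by
  classical
  have hex : ∃ k, Φ.AppliesAt C n k := by
    obtain ⟨k, σ, hk, hσ⟩ := h
    exact ⟨k, σ, b, hk, hσ⟩
  obtain ⟨σ, b', hk, hσ⟩ := Nat.find_spec hex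
  obtain rfl : b = b' := h.unique ⟨_, σ, hk, hσ⟩
  by_cases hm : ∃ p ∈ σ, p.1 = m
  · exact Or.inl ⟨_, σ, b, hk, hσ, fun k' hk' => Nat.find_min hex hk', hm⟩
  · exact Or.inr ⟨_, σ, hk, hσ, fun p hp hpm => hm ⟨p, hp, hpm⟩⟩

end TuringFunctional

theorem FinInfo.exists_bound (σ : FinInfo) : ∃ L, ∀ p ∈ σ, p.1 < L := by
  induction σ with
  | nil => exact ⟨0, by simp⟩
  | cons q σ ih =>
    obtain ⟨L, hL⟩ := ih
    refine ⟨max L (q.1 + 1), fun p hp => ?_⟩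
    rcases List.mem_cons.1 hp with rfl | hp
    · omega
    · have := hL p hp
      omega

theorem AgreesSet.congr {σ : FinInfo} {C C' : Set ℕ} (h : AgreesSet σ C)
    (hC : ∀ p ∈ σ, p.1 ∈ C' ↔ p.1 ∈ C) : AgreesSet σ C' :=
  fun p hp => (h p hp).trans (hC p hp).symm

namespace TuringFunctional

theorem exists_bound (Φ : TuringFunctional) (k : ℕ) :
    ∃ L, ∀ k' < k, ∀ σ n b, Φ.axs k' = some (σ, n, b) → ∀ p ∈ σ, p.1 < L := by
  induction k with
  | zero => exact ⟨0, by simp⟩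
  | succ k ih =>
    obtain ⟨L, hL⟩ := ih
    obtain ⟨L', hL'⟩ : ∃ L', ∀ σ n b, Φ.axs k = some (σ, n, b) → ∀ p ∈ σ, p.1 < L' := by
      rcases hk : Φ.axs k with _ | ⟨σ, n, b⟩
      · exact ⟨0, by simp⟩
      · obtain ⟨L', hL'⟩ := σ.exists_bound
        refine ⟨L', fun σ' n' b' h => ?_⟩
        simp only [Option.some.injEq, Prod.mk.injEq] at h
        rw [← h.1]
        exact hL'
    refine ⟨max L L', fun k' hk' σ n b h p hp => ?_⟩
    rcases Nat.lt_succ_iff_lt_or_eq.1 hk' with hlt | rfl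
    · exact lt_max_of_lt_left (hL k' hlt σ n b h p hp)
    · exact lt_max_of_lt_right (hL' σ n b h p hp)

theorem QueriesAt.exists_use {Φ : TuringFunctional} {C : Set ℕ} {n m : ℕ}
    (h : Φ.QueriesAt C n m) :
    ∃ L, ∀ C' : Set ℕ, (∀ x < L, x ∈ C' ↔ x ∈ C) → Φ.QueriesAt C' n m := by
  obtain ⟨k, σ, b, hk, hσ, hmin, hm⟩ := h
  obtain ⟨L, hL⟩ := Φ.exists_bound (k + 1)
  refine ⟨L, fun C' hC => ⟨k, σ, b, hk,
    hσ.congr fun p hp => hC _ (hL k k.lt_succ_self σ n b hk p hp), ?_, hm⟩⟩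
  rintro k' hk' ⟨τ, b', hτ, hag⟩
  exact hmin k' hk' ⟨τ, b', hτ,
    hag.congr fun p hp => (hC _ (hL k' (by omega) τ n b' hτ p hp)).symm⟩

instance : Countable TuringFunctional := by
  refine Function.Injective.countable
    (f := fun Φ : TuringFunctional => (⟨fun k => Encodable.encode (Φ.axs k),
      Computable.encode.comp Φ.axs_computable⟩ : {f : ℕ → ℕ // Computable f})) ?_
  rintro ⟨f, hf, hf'⟩ ⟨g, hg, hg'⟩ h
  obtain rfl : f = g := funext fun k =>
    Encodable.encode_injective (congrFun (congrArg Subtype.val h) k)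
  rfl

end TuringFunctional

/-- `A` allows the coded set to be decided at `n`, and without reading the switch if this switch
is one of the first `N`. -/
def Admissible (N : ℕ) (A : Set ℕ) (n : ℕ) : Prop :=
  (Nat.pair n.unpair.1 0 ∈ A ∨ ∃ s, FirstMark A n s) ∧
    (n.unpair.1 < N → ∃ s, s.bodd = false ∧ FirstMark A n s)

theorem Admissible.of_firstMark {N : ℕ} {A : Set ℕ} {n s : ℕ} (hs : s.bodd = false)
    (h : FirstMark A n s) : Admissible N A n :=
  ⟨Or.inr ⟨s, h⟩, fun _ => ⟨s, hs, h⟩⟩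

theorem Admissible.anti {N M : ℕ} {A : Set ℕ} {n : ℕ} (h : Admissible M A n) (hNM : N ≤ M) :
    Admissible N A n :=
  ⟨h.1, fun hn => h.2 (hn.trans_le hNM)⟩

theorem Admissible.congr {N M : ℕ} {A A' : Set ℕ} {n : ℕ} (h : Admissible N A n) (hn : n < M)
    (hA : ∀ x, x.unpair.1 < M → (x ∈ A ↔ x ∈ A')) : Admissible N A' n := by
  have hrow : ∀ t, Nat.pair n (t + 1) ∈ A ↔ Nat.pair n (t + 1) ∈ A' := fun t =>
    hA _ (by simpa using hn)
  refine ⟨h.1.imp (fun hsw => (hA _ ?_).1 hsw) fun ⟨s, hs⟩ => ⟨s, hs.congr hrow⟩,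
    fun he => (h.2 he).imp fun s hs => ⟨hs.1, hs.2.congr hrow⟩⟩
  simpa using (Nat.unpair_left_le n).trans_lt hn

/-- A forcing condition: the rows of `set` below `height` are decided. -/
structure RowCond where
  /-- A set whose first rows are the decided part. -/
  set : Set ℕ
  /-- The number of decided rows. -/
  height : ℕ

namespace RowCond

instance : Preorder RowCond where
  le p q := p.height ≤ q.height ∧ (∀ x, x.unpair.1 < p.height → (x ∈ p.set ↔ x ∈ q.set)) ∧
    ∀ n, p.height ≤ n → n < q.height → Admissible p.height q.set n
  le_refl p := ⟨le_rfl, fun _ _ => Iff.rfl, fun n h h' => absurd h' h.not_gt⟩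
  le_trans p q r hpq hqr := by
    refine ⟨hpq.1.trans hqr.1, fun x hx => (hpq.2.1 x hx).trans (hqr.2.1 x (hx.trans_le hpq.1)),
      fun n hn hn' => ?_⟩
    rcases lt_or_ge n q.height with h | h
    · exact (hpq.2.2 n hn h).congr h hqr.2.1
    · exact (hqr.2.2 n h hn').anti hpq.1

/-- `A` is a possible outcome of a construction passing through the condition `p`. -/
def Realizes (p : RowCond) (A : Set ℕ) : Prop :=
  (∀ x, x.unpair.1 < p.height → (x ∈ p.set ↔ x ∈ A)) ∧
    ∀ n, p.height ≤ n → Admissible p.height A n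

theorem Realizes.le {p : RowCond} {A : Set ℕ} (h : p.Realizes A) {M : ℕ} (hM : p.height ≤ M) :
    p ≤ ⟨A, M⟩ :=
  ⟨hM, h.1, fun n hn _ => h.2 n hn⟩

theorem Realizes.of_le {p q : RowCond} {A : Set ℕ} (h : q.Realizes A) (hpq : p ≤ q) :
    p.Realizes A := by
  refine ⟨fun x hx => (hpq.2.1 x hx).trans (h.1 x (hx.trans_le hpq.1)), fun n hn => ?_⟩
  rcases lt_or_ge n q.height with h' | h'
  · exact (hpq.2.2 n hn h').congr h' h.1
  · exact (h.2 n h').anti hpq.1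

/-- The undecided rows are filled by turning the switch on and marking the first place. -/
def fill (p : RowCond) : Set ℕ :=
  {x | (x.unpair.1 < p.height ∧ x ∈ p.set) ∨ (p.height ≤ x.unpair.1 ∧ x.unpair.2 ≤ 1)}

theorem mem_fill_of_lt {p : RowCond} {x : ℕ} (hx : x.unpair.1 < p.height) :
    x ∈ p.set ↔ x ∈ p.fill := by
  simp [fill, hx]

theorem pair_mem_fill {p : RowCond} {n t : ℕ} (hn : p.height ≤ n) :
    Nat.pair n t ∈ p.fill ↔ t ≤ 1 := by
  simp [fill, hn]

theorem realizes_fill (p : RowCond) : p.Realizes p.fill :=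
  ⟨fun _ => mem_fill_of_lt, fun n hn => .of_firstMark (s := 0) rfl
    ⟨(pair_mem_fill hn).2 le_rfl, by simp⟩⟩

/-- A chain of conditions deciding countably many prescribed sets of conditions, together with
its limit. -/
theorem exists_generic {ι : Type} [Countable ι] (S : ι → Set RowCond) (p : RowCond) :
    ∃ (f : ℕ → RowCond) (A : Set ℕ), Monotone f ∧ (∀ k, (f k).Realizes A) ∧ f 0 = p ∧
      (∀ N, ∃ k, N ≤ (f k).height) ∧ ∀ i, ∃ k, f k ∈ S i ∨ ∀ q ≥ f k, q ∉ S i := by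
  have := Encodable.ofCountable ι
  let D : ι ⊕ ℕ → Order.Cofinal RowCond := Sum.elim
    (fun i => ⟨{q | q ∈ S i ∨ ∀ r ≥ q, r ∉ S i}, fun q => by
      by_cases h : ∃ r ≥ q, r ∈ S i
      · obtain ⟨r, hr, hrS⟩ := h
        exact ⟨r, Or.inl hrS, hr⟩
      · exact ⟨q, Or.inr (by simpa using h), le_rfl⟩⟩)
    (fun N => ⟨{q | N ≤ q.height}, fun q =>
      ⟨⟨q.fill, max N q.height⟩, le_max_left N q.height, q.realizes_fill.le (le_max_right _ _)⟩⟩)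
  let f := Order.sequenceOfCofinals p D
  have hf : Monotone f := Order.sequenceOfCofinals.monotone p D
  have hN : ∀ N, ∃ k, N ≤ (f k).height := fun N =>
    ⟨_, Order.sequenceOfCofinals.encode_mem p D (Sum.inr N)⟩
  let A : Set ℕ := {x | ∃ k, x.unpair.1 < (f k).height ∧ x ∈ (f k).set}
  have hA : ∀ k x, x.unpair.1 < (f k).height → (x ∈ (f k).set ↔ x ∈ A) := by
    intro k x hx
    refine ⟨fun h => ⟨k, hx, h⟩, ?_⟩
    rintro ⟨j, hj, hxj⟩
    rcases le_total j k with h | h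
    · exact ((hf h).2.1 x hj).1 hxj
    · exact ((hf h).2.1 x hx).2 hxj
  refine ⟨f, A, hf, fun k => ⟨hA k, fun n hn => ?_⟩, rfl, hN, fun i =>
    ⟨_, Order.sequenceOfCofinals.encode_mem p D (Sum.inl i)⟩⟩
  obtain ⟨j, hj⟩ := hN (n + 1)
  have hkj : k ≤ j := by
    by_contra h
    have := (hf (not_le.1 h).le).1
    omega
  exact ((hf hkj).2.2 n hn (by omega)).congr hj (fun x hx => hA j x (by omega))

/-- Every outcome of `p` defeats `Φ`. -/
def Defeats (p : RowCond) (Φ : TuringFunctional) : Prop :=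
  ∀ A, p.Realizes A → ¬ Φ.FunEq A (coded A)

/-- For every outcome of `p`, the computation of `Φ` on `n` reads the switch `e`. -/
def ForcesQuery (p : RowCond) (Φ : TuringFunctional) (e n : ℕ) : Prop :=
  ∀ A, p.Realizes A → Φ.QueriesAt A n (Nat.pair e 0)

/-- `Φ` can be forced to read the switch `e` on arbitrarily large inputs. -/
def RecurrentQuery (p : RowCond) (Φ : TuringFunctional) (e : ℕ) : Prop :=
  ∀ q ≥ p, ∀ m, ∃ r ≥ q, ∃ n ≥ m, r.ForcesQuery Φ e n

theorem exists_defeats_or_recurrentQuery (Φ : TuringFunctional) (p : RowCond) :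
    ∃ q ≥ p, q.Defeats Φ ∨ ∃ e, q.RecurrentQuery Φ e := by
  by_cases hdef : ∃ q ≥ p, q.Defeats Φ
  · obtain ⟨q, hq, hΦ⟩ := hdef
    exact ⟨q, hq, Or.inl hΦ⟩
  obtain ⟨N, hN⟩ : ∃ N, N = p.height := ⟨_, rfl⟩
  refine ⟨⟨p.fill, N + 1⟩, p.realizes_fill.le (by omega), Or.inr ⟨N, fun q hq m => ?_⟩⟩
  have hpq : p ≤ q := (p.realizes_fill.le (by omega)).trans hq
  have hNq : N + 1 ≤ q.height := hq.1
  obtain ⟨n, hnm, hnq, hnN⟩ : ∃ n, m ≤ n ∧ q.height ≤ n ∧ n.unpair.1 = N :=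
    ⟨Nat.pair N (max m q.height), (le_max_left _ _).trans (Nat.right_le_pair _ _),
      (le_max_right _ _).trans (Nat.right_le_pair _ _), by simp⟩
  -- Hold the row `n` empty and find an outcome on which `Φ` is still correct.
  let Y : Set ℕ := {x | x ∈ q.fill ∧ (x.unpair.1 = n → x.unpair.2 = 0)}
  have hYq : ∀ x, x.unpair.1 < q.height → (x ∈ q.set ↔ x ∈ Y) := by
    intro x hx
    have : x.unpair.1 ≠ n := by omega
    simp [Y, mem_fill_of_lt hx, this]
  have hYmark : ∀ n', q.height ≤ n' → n' ≠ n → FirstMark Y n' 0 := by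
    intro n' hn' hne
    exact ⟨by simp [Y, pair_mem_fill hn', hne], by simp⟩
  have hswq : Nat.pair N 0 ∈ q.set :=
    (hq.2.1 _ (by simp)).1 ((pair_mem_fill hN.ge).2 zero_le_one)
  have hY : p.Realizes Y := by
    refine ⟨fun x hx => (hpq.2.1 x hx).trans (hYq x (hx.trans_le hpq.1)), fun n' hn' => ?_⟩
    rcases lt_or_ge n' q.height with h | h
    · exact (hpq.2.2 n' hn' h).congr h hYq
    · by_cases hne : n' = n
      · subst hne
        exact ⟨Or.inl (by rw [hnN]; exact (hYq _ (by simp; omega)).1 hswq), fun h => by omega⟩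
      · exact .of_firstMark (s := 0) rfl (hYmark n' h hne)
  have hpY : p ≤ ⟨Y, n + 1⟩ := hY.le (by omega)
  obtain ⟨A, hYA, hΦ⟩ : ∃ A, RowCond.Realizes ⟨Y, n + 1⟩ A ∧ Φ.FunEq A (coded A) := by
    by_contra hA
    exact hdef ⟨_, hpY, fun A hA₁ hA₂ => hA ⟨A, hA₁, hA₂⟩⟩
  have hpA : p.Realizes A := hYA.of_le hpY
  have hqA : ∀ x, x.unpair.1 < q.height → (x ∈ q.set ↔ x ∈ A) := fun x hx =>
    (hYq x hx).trans (hYA.1 x (show x.unpair.1 < n + 1 by omega))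
  have hsw : Nat.pair N 0 ∈ A := (hqA _ (by simp; omega)).1 hswq
  have hempty : ∀ t, Nat.pair n (t + 1) ∉ A := fun t h => by
    have := (hYA.1 (Nat.pair n (t + 1)) (by simp)).2 h
    simp [Y] at this
  have hmark : ∀ n', q.height ≤ n' → n' ≠ n → n'.unpair.1 < n + 1 →
      ∃ s, s.bodd = false ∧ FirstMark A n' s := by
    intro n' hn' hne hlt
    rcases lt_or_ge n' (n + 1) with h | h
    · exact ⟨0, rfl, (hYmark n' hn' hne).congr fun t => hYA.1 _ (by simpa using h)⟩
    · exact (hYA.2 n' h).2 hlt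
  have hout : Φ.HaltsT A n false := by
    obtain ⟨b, hb⟩ := hΦ.1 n
    have hn : n ∉ coded A := fun h => h.1 (by rwa [hnN])
    rwa [Bool.eq_false_iff.2 fun h => hn ((hΦ.2 n b hb).1 h)] at hb
  rcases hout.queriesAt_or (Nat.pair N 0) with hquery | ⟨k, σ, hk, hσ, hσN⟩
  · -- Marking row `n` at a late even place preserves the computation.
    obtain ⟨L, hL⟩ := hquery.exists_use
    let A' : Set ℕ := insert (Nat.pair n (2 * L + 1)) A
    have hrow : ∀ x, x.unpair.1 ≠ n → (x ∈ A ↔ x ∈ A') := fun x hx => by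
      have : x ≠ Nat.pair n (2 * L + 1) := fun h => hx (by simp [h])
      simp [A', this]
    refine ⟨⟨A', max L (n + 1)⟩, ⟨by simp; omega, fun x hx => (hqA x hx).trans
      (hrow x (by omega)), fun n' hn' _ => ?_⟩, n, hnm, fun C hC => hL C fun x hx => ?_⟩
    · by_cases hne : n' = n
      · subst hne
        exact .of_firstMark (s := 2 * L) (by simp)
          ⟨by simp [A'], fun t ht => by simp [A', hempty]; omega⟩
      · have hmono : A ⊆ A' := Set.subset_insert _ _
        have hcongr : ∀ t, Nat.pair n' (t + 1) ∈ A ↔ Nat.pair n' (t + 1) ∈ A' :=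
          fun t => hrow _ (by simpa using hne)
        exact ⟨(hpA.2 n' (by omega)).1.imp (fun h => hmono h) fun ⟨s, hs⟩ => ⟨s, hs.congr hcongr⟩,
          fun h => (hmark n' hn' hne (by omega)).imp fun s hs => ⟨hs.1, hs.2.congr hcongr⟩⟩
    · have h₁ := hC.1 x ((Nat.unpair_left_le x).trans_lt (lt_max_of_lt_left hx))
      have h₂ : x ≠ Nat.pair n (2 * L + 1) := by
        have := Nat.right_le_pair n (2 * L + 1)
        omega
      rw [← h₁]
      simp [A', h₂]
  · -- Turning off the switch and marking row `n` at a late odd place defeats `Φ`.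
    exfalso
    obtain ⟨L, hL⟩ := σ.exists_bound
    let A' : Set ℕ := insert (Nat.pair n (2 * L + 2)) (A \ {Nat.pair N 0})
    have hA' : ∀ x, x ≠ Nat.pair N 0 → x ≠ Nat.pair n (2 * L + 2) → (x ∈ A ↔ x ∈ A') :=
      fun x h₁ h₂ => by simp [A', h₁, h₂]
    have hrow : ∀ n' ≠ n, ∀ t, Nat.pair n' (t + 1) ∈ A ↔ Nat.pair n' (t + 1) ∈ A' :=
      fun n' hne t => hA' _ (by simp [Nat.pair_eq_pair]) (by simp [Nat.pair_eq_pair, hne])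
    have hoff : Nat.pair N 0 ∉ A' := by simp [A', Nat.pair_eq_pair]
    have hnew : FirstMark A' n (2 * L + 1) :=
      ⟨by simp [A'], fun t ht => by simp [A', hempty, Nat.pair_eq_pair]; omega⟩
    have hmarkN : ∀ n', N ≤ n' → n' ≠ n → n'.unpair.1 = N → ∃ s, FirstMark A n' s := by
      intro n' hn' hne he
      rcases lt_or_ge n' q.height with h | h
      · rcases hn'.eq_or_lt with rfl | hlt
        · exact exists_firstMark (t := 0) ((hqA _ (by simpa using h)).1
            ((hq.2.1 _ (by simp)).1 ((pair_mem_fill hN.ge).2 le_rfl)))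
        · obtain ⟨s, -, hs⟩ := (hq.2.2 n' hlt h).2 (show n'.unpair.1 < N + 1 by omega)
          exact ⟨s, hs.congr fun t => hqA _ (by simpa using h)⟩
      · obtain ⟨s, -, hs⟩ := hmark n' h hne (by omega)
        exact ⟨s, hs⟩
    refine hdef ⟨⟨A', max L (n + 1)⟩, ⟨by simp; omega, fun x hx => (hpA.1 x hx).trans
      (hA' x ?_ ?_), fun n' hn' _ => ?_⟩, fun C hC hfun => ?_⟩
    · rintro rfl
      simp at hx
      omega
    · rintro rfl
      simp at hx
      omega
    · by_cases hne : n' = n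
      · subst hne
        exact ⟨Or.inr ⟨_, hnew⟩, fun h => by omega⟩
      · have hold := hpA.2 n' hn'
        refine ⟨?_, fun h => (hold.2 h).imp fun s hs => ⟨hs.1, hs.2.congr (hrow n' hne)⟩⟩
        by_cases he : n'.unpair.1 = N
        · exact Or.inr ((hmarkN n' (by omega) hne he).imp fun s hs => hs.congr (hrow n' hne))
        · exact hold.1.imp
            (fun h => (hA' _ (by simp [Nat.pair_eq_pair, he]) (by simp [Nat.pair_eq_pair])).1 h)
            fun ⟨s, hs⟩ => ⟨s, hs.congr (hrow n' hne)⟩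
    · have hCA : ∀ x, x.unpair.1 < max L (n + 1) → (x ∈ A' ↔ x ∈ C) := hC.1
      have hcoded : n ∈ coded C := by
        refine ⟨?_, 2 * L + 1, by simp, hnew.congr fun t => hCA _ (by simp)⟩
        rw [hnN, ← hCA _ (by simp; omega)]
        exact hoff
      have hhalt : Φ.HaltsT C n false := by
        refine ⟨k, σ, hk, hσ.congr fun x hx => ?_⟩
        have hxL := hL x hx
        rw [hA' x.1 (hσN x hx) (by have := Nat.right_le_pair n (2 * L + 2); omega)]
        exact (hCA _ ((Nat.unpair_left_le _).trans_lt (lt_max_of_lt_left hxL))).symm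
      simpa using (hfun.2 n false hhalt).2 hcoded

end RowCond

theorem exists_cofinite_red_not_ubfb_red :
    ∃ A B : Set ℕ, CofinRed B A ∧ ¬ UbfbRed B A := by
  obtain ⟨f, A, hf, hA, h0, hN, hS⟩ := RowCond.exists_generic
    (Sum.elim (fun Φ : TuringFunctional => {q | q.Defeats Φ ∨ ∃ e, q.RecurrentQuery Φ e})
      (fun x : TuringFunctional × ℕ × ℕ => {q | ∃ n ≥ x.2.2, q.ForcesQuery x.1 x.2.1 n})) ⟨∅, 0⟩
  refine ⟨A, coded A, cofinRed_coded (fun n => ?_) (fun e => ?_), ?_⟩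
  · have := (hA 0).2 n
    rw [h0] at this
    exact (this n.zero_le).1
  · obtain ⟨k, hk⟩ := hN e
    exact ⟨(f k).height, fun n hn he => ((hA k).2 n hn).2 (he.trans_le hk)⟩
  · rintro ⟨Φ, hΦ, huse⟩
    obtain ⟨k, hk⟩ := hS (Sum.inl Φ)
    replace hk : (f k).Defeats Φ ∨ ∃ e, (f k).RecurrentQuery Φ e := by
      refine hk.resolve_right fun h => ?_
      obtain ⟨q, hq, hqS⟩ := RowCond.exists_defeats_or_recurrentQuery Φ (f k)
      exact h q hq hqS
    obtain ⟨e, he⟩ := hk.resolve_left fun h => h A (hA k) hΦ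
    obtain ⟨m, hm⟩ := Filter.eventually_atTop.1 (huse (Nat.pair e 0))
    obtain ⟨j, ⟨n, hn, hq⟩ | hj⟩ := hS (Sum.inr (Φ, e, m))
    · exact hm n hn (hq A (hA j))
    · obtain ⟨r, hr, hrS⟩ := he (f (max j k)) (hf (le_max_right j k)) m
      exact hj r ((hf (le_max_left j k)).trans hr) hrS
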